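/- Fix(φ) is a finite set if and only if condition (★) holds. -/

import Mathlib

open Module

namespace BZSVFix

variable {Γ : Type*} [Group Γ]

/-- A subspace `U ⊆ ℂ^d` is `Γ`-invariant for the representation `φ`. -/
def IsInvariant {d : ℕ} (φ : Representation ℂ Γ (Fin d → ℂ))
    (U : Submodule ℂ (Fin d → ℂ)) : Prop :=
  ∀ γ : Γ, ∀ x ∈ U, φ γ x ∈ U

/-- A `Γ`-invariant subspace is irreducible if it is nonzero and contains no `Γ`-invariant
subspace other than `0` and itself. -/
def IsIrreducibleInv {d : ℕ} (φ : Representation ℂ Γ (Fin d → ℂ))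
    (U : Submodule ℂ (Fin d → ℂ)) : Prop :=
  U ≠ ⊥ ∧ ∀ U' : Submodule ℂ (Fin d → ℂ), U' ≤ U → IsInvariant φ U' → U' = ⊥ ∨ U' = U

/-- Two `Γ`-invariant subspaces are isomorphic as `Γ`-modules: there is a `ℂ`-linear bijection
between them commuting with the action of every `φ γ`. -/
def IsoAsRep {d : ℕ} (φ : Representation ℂ Γ (Fin d → ℂ))
    (U₁ U₂ : Submodule ℂ (Fin d → ℂ)) : Prop :=
  ∃ e : U₁ ≃ₗ[ℂ] U₂, ∀ (γ : Γ) (x : Fin d → ℂ) (hx : x ∈ U₁) (hγx : φ γ x ∈ U₁),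
    ((e ⟨φ γ x, hγx⟩ : U₂) : Fin d → ℂ) = φ γ ((e ⟨x, hx⟩ : U₂) : Fin d → ℂ)

/-- `Fix(φ)`: the set of pairs `(V, W)` of `Γ`-invariant subspaces of `ℂ^d` with
`dim V = n`, `dim W = n + m`, `V ∩ W = 0` and `V + W = ℂ^d`. -/
def FixSet (n m : ℕ) {d : ℕ} (φ : Representation ℂ Γ (Fin d → ℂ)) :
    Set (Submodule ℂ (Fin d → ℂ) × Submodule ℂ (Fin d → ℂ)) :=
  {p | IsInvariant φ p.1 ∧ IsInvariant φ p.2 ∧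
    finrank ℂ p.1 = n ∧ finrank ℂ p.2 = n + m ∧ p.1 ⊓ p.2 = ⊥ ∧ p.1 ⊔ p.2 = ⊤}

/-- Condition (★): for every subset `I` of the index set with `∑_{i ∈ I} n_i = n`, the
constituents `U_i`, `i ∈ I`, and `U_j`, `j ∉ I`, are pairwise non-isomorphic. -/
def StarCondition {k : ℕ} (n : ℕ) (nι : Fin k → ℕ) {d : ℕ}
    (φ : Representation ℂ Γ (Fin d → ℂ)) (U : Fin k → Submodule ℂ (Fin d → ℂ)) : Prop :=
  ∀ I : Finset (Fin k), (∑ i ∈ I, nι i) = n →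
    ∀ i ∈ I, ∀ j ∉ I, ¬ IsoAsRep φ (U i) (U j)

section Invariant

variable {d : ℕ} {φ : Representation ℂ Γ (Fin d → ℂ)}

theorem IsInvariant.inf {V W : Submodule ℂ (Fin d → ℂ)} (hV : IsInvariant φ V)
    (hW : IsInvariant φ W) : IsInvariant φ (V ⊓ W) :=
  fun γ x hx => ⟨hV γ x hx.1, hW γ x hx.2⟩

theorem IsInvariant.map {V : Submodule ℂ (Fin d → ℂ)} (hV : IsInvariant φ V)
    {T : End ℂ (Fin d → ℂ)} (hT : ∀ γ x, T (φ γ x) = φ γ (T x)) : IsInvariant φ (V.map T) := by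
  rintro γ _ ⟨x, hx, rfl⟩
  exact ⟨φ γ x, hV γ x hx, hT γ x⟩

theorem isInvariant_ker {T : End ℂ (Fin d → ℂ)} (hT : ∀ γ x, T (φ γ x) = φ γ (T x)) :
    IsInvariant φ (LinearMap.ker T) := by
  intro γ x hx
  rw [LinearMap.mem_ker] at hx ⊢
  rw [hT, hx, map_zero]

theorem IsInvariant.iSup {ι : Sort*} {V : ι → Submodule ℂ (Fin d → ℂ)}
    (hV : ∀ i, IsInvariant φ (V i)) : IsInvariant φ (⨆ i, V i) := by
  intro γ
  have h : (⨆ i, V i) ≤ (⨆ i, V i).comap (φ γ) :=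
    iSup_le fun i x hx => Submodule.mem_iSup_of_mem i (hV i γ x hx)
  exact fun x hx => h hx

theorem IsInvariant.sup {V W : Submodule ℂ (Fin d → ℂ)} (hV : IsInvariant φ V)
    (hW : IsInvariant φ W) : IsInvariant φ (V ⊔ W) := by
  rw [sup_eq_iSup]
  exact IsInvariant.iSup fun b => by cases b <;> assumption

/-- The projection onto an invariant subspace along an invariant complement is equivariant. -/
theorem projection_comm {V W : Submodule ℂ (Fin d → ℂ)} (hV : IsInvariant φ V)
    (hW : IsInvariant φ W) (h : IsCompl V W) (γ : Γ) (x : Fin d → ℂ) :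
    V.projection W h (φ γ x) = φ γ (V.projection W h x) := by
  have key : φ γ x = φ γ (V.projection W h x) + φ γ (x - V.projection W h x) := by
    rw [← map_add, add_sub_cancel]
  conv_lhs => rw [key]
  rw [map_add, Submodule.projection_apply_of_mem_left h
      (hV γ _ (Submodule.projection_apply_mem h x)),
    (Submodule.projection_apply_eq_zero_iff h).2 (hW γ _ (Submodule.sub_projection_mem h x)),
    add_zero]

theorem IsoAsRep.symm {U₁ U₂ : Submodule ℂ (Fin d → ℂ)} (h₁ : IsInvariant φ U₁)
    (h : IsoAsRep φ U₁ U₂) : IsoAsRep φ U₂ U₁ := by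
  obtain ⟨e, he⟩ := h
  refine ⟨e.symm, fun γ y hy hγy => ?_⟩
  have hx := h₁ γ _ (e.symm ⟨y, hy⟩).2
  have h := he γ _ (e.symm ⟨y, hy⟩).2 hx
  rw [Subtype.coe_eta, LinearEquiv.apply_symm_apply] at h
  have h' : e ⟨_, hx⟩ = ⟨φ γ y, hγy⟩ := Subtype.ext h
  rw [← h', LinearEquiv.symm_apply_apply]

/-- Schur's lemma: an equivariant map between non-isomorphic irreducible subspaces vanishes. -/
theorem eq_zero_of_not_isoAsRep {U₁ U₂ : Submodule ℂ (Fin d → ℂ)} (h₁ : IsInvariant φ U₁)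
    (hirr₁ : IsIrreducibleInv φ U₁) (hirr₂ : IsIrreducibleInv φ U₂)
    (hiso : ¬ IsoAsRep φ U₁ U₂) {T : End ℂ (Fin d → ℂ)}
    (hT : ∀ γ x, T (φ γ x) = φ γ (T x)) (hmaps : ∀ x ∈ U₁, T x ∈ U₂) :
    ∀ x ∈ U₁, T x = 0 := by
  by_contra! hne
  obtain ⟨x₀, hx₀, hTx₀⟩ := hne
  have hker : U₁ ⊓ LinearMap.ker T = ⊥ := by
    refine (hirr₁.2 _ inf_le_left (h₁.inf (isInvariant_ker hT))).resolve_right fun h => ?_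
    exact hTx₀ (inf_eq_left.1 h hx₀)
  have hmap : U₁.map T = U₂ := by
    refine (hirr₂.2 _ (Submodule.map_le_iff_le_comap.2 hmaps) (h₁.map hT)).resolve_left fun h => ?_
    exact hTx₀ ((Submodule.eq_bot_iff _).1 h _ (Submodule.mem_map_of_mem hx₀))
  refine hiso ⟨LinearEquiv.ofBijective (T.restrict hmaps) ⟨?_, ?_⟩, fun γ x hx hγx => hT γ x⟩
  · rw [← LinearMap.ker_eq_bot, LinearMap.ker_eq_bot']
    intro x hx
    have hTx : T x = 0 := congrArg Subtype.val hx
    exact Subtype.ext ((Submodule.eq_bot_iff _).1 hker _ ⟨x.2, hTx⟩)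
  · rintro ⟨y, hy⟩
    rw [← hmap] at hy
    obtain ⟨x, hx, rfl⟩ := hy
    exact ⟨⟨x, hx⟩, rfl⟩

end Invariant

section Decomposition

variable {d k : ℕ} {φ : Representation ℂ Γ (Fin d → ℂ)} {U : Fin k → Submodule ℂ (Fin d → ℂ)}

theorem isCompl_iSup_ne (hsum : DirectSum.IsInternal U) (i : Fin k) :
    IsCompl (U i) (⨆ j ≠ i, U j) := by
  refine ⟨hsum.submodule_iSupIndep i, codisjoint_iff.2 ?_⟩
  rw [← hsum.submodule_iSup_eq_top, sup_comm]
  refine le_antisymm (sup_le (iSup₂_le fun j _ => le_iSup U j) (le_iSup U i)) (iSup_le fun j => ?_)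
  obtain rfl | h := eq_or_ne j i
  · exact le_sup_right
  · exact le_sup_of_le_left (le_iSup₂_of_le j h le_rfl)

theorem sum_projection_eq (hsum : DirectSum.IsInternal U) (x : Fin d → ℂ) :
    ∑ i, (U i).projection _ (isCompl_iSup_ne hsum i) x = x := by
  have hx : x ∈ ⨆ i, U i := hsum.submodule_iSup_eq_top ▸ Submodule.mem_top
  induction hx using Submodule.iSup_induction' with
  | mem j y hy =>
    rw [Finset.sum_eq_single j]
    · exact Submodule.projection_apply_of_mem_left _ hy
    · intro i _ hij
      exact (Submodule.projection_apply_eq_zero_iff _).2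
        (Submodule.mem_iSup_of_mem j (Submodule.mem_iSup_of_mem hij.symm hy))
    · simp
  | zero => simp
  | add y z _ _ hy hz => simp only [map_add, Finset.sum_add_distrib, hy, hz]

theorem mem_biSup_of_projection_eq_zero (hsum : DirectSum.IsInternal U) {J : Finset (Fin k)}
    {x : Fin d → ℂ}
    (hx : ∀ i ∉ J, (U i).projection _ (isCompl_iSup_ne hsum i) x = 0) : x ∈ ⨆ i ∈ J, U i := by
  rw [← sum_projection_eq hsum x]
  refine Submodule.sum_mem _ fun i _ => ?_
  by_cases hi : i ∈ J
  · exact Submodule.mem_iSup_of_mem i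
      (Submodule.mem_iSup_of_mem hi (Submodule.projection_apply_mem _ _))
  · rw [hx i hi]
    exact Submodule.zero_mem _

theorem isCompl_biSup_compl (hsum : DirectSum.IsInternal U) (J : Finset (Fin k)) :
    IsCompl (⨆ i ∈ J, U i) (⨆ i ∈ Jᶜ, U i) := by
  refine ⟨?_, codisjoint_iff.2 (top_unique ?_)⟩
  · have h := hsum.submodule_iSupIndep.disjoint_biSup_biSup
      (Finset.disjoint_coe.2 (disjoint_compl_right (a := J)))
    simpa only [Finset.mem_coe] using h
  · rw [← hsum.submodule_iSup_eq_top]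
    refine iSup_le fun i => ?_
    by_cases hi : i ∈ J
    · exact le_sup_of_le_left (le_iSup₂_of_le i hi le_rfl)
    · exact le_sup_of_le_right (le_iSup₂_of_le i (Finset.mem_compl.2 hi) le_rfl)

theorem finrank_biSup (hsum : DirectSum.IsInternal U) (J : Finset (Fin k)) :
    finrank ℂ (⨆ i ∈ J, U i : Submodule ℂ (Fin d → ℂ)) = ∑ i ∈ J, finrank ℂ (U i) := by
  induction J using Finset.induction_on with
  | empty => simp
  | insert a J ha ih =>
    have hdisj : U a ⊓ (⨆ i ∈ J, U i) = ⊥ :=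
      disjoint_iff.1 ((isCompl_iSup_ne hsum a).disjoint.mono_right
        (biSup_mono fun i hi => ne_of_mem_of_not_mem hi ha))
    have h := Submodule.finrank_sup_add_finrank_inf_eq (U a) (⨆ i ∈ J, U i)
    rw [hdisj, finrank_bot, add_zero, ih] at h
    rw [Finset.iSup_insert, h, Finset.sum_insert ha]

/-- An invariant subspace has a complement that is a sum of some of the given irreducible
subspaces. -/
theorem exists_isCompl_biSup (hsum : DirectSum.IsInternal U) (hinv : ∀ i, IsInvariant φ (U i))
    (hirr : ∀ i, IsIrreducibleInv φ (U i)) {W : Submodule ℂ (Fin d → ℂ)}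
    (hW : IsInvariant φ W) : ∃ J : Finset (Fin k), IsCompl W (⨆ i ∈ J, U i) := by
  obtain ⟨J, hJ⟩ := Set.Finite.exists_maximal
    (s := {J : Finset (Fin k) | Disjoint W (⨆ i ∈ J, U i)}) (Set.toFinite _) ⟨∅, by simp⟩
  refine ⟨J, hJ.prop, codisjoint_iff.2 (top_unique ?_)⟩
  rw [← hsum.submodule_iSup_eq_top]
  refine iSup_le fun i => ?_
  have hinvJ : IsInvariant φ (W ⊔ ⨆ i ∈ J, U i) :=
    hW.sup (IsInvariant.iSup fun i => IsInvariant.iSup fun _ => hinv i)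
  rcases (hirr i).2 _ inf_le_left ((hinv i).inf hinvJ) with h | h
  · have hdisj : Disjoint W (⨆ j ∈ insert i J, U j) := by
      rw [Finset.iSup_insert, sup_comm]
      exact hJ.prop.disjoint_sup_right_of_disjoint_sup_left (disjoint_iff.2 h).symm
    have hi : i ∈ J := hJ.le_of_ge hdisj (Finset.subset_insert i J) (Finset.mem_insert_self i J)
    exact le_sup_of_le_right (le_iSup₂_of_le i hi le_rfl)
  · exact inf_eq_left.1 h

theorem eq_biSup_of_isCompl (hsum : DirectSum.IsInternal U) (hinv : ∀ i, IsInvariant φ (U i))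
    (hirr : ∀ i, IsIrreducibleInv φ (U i)) {V W : Submodule ℂ (Fin d → ℂ)}
    (hV : IsInvariant φ V) (hW : IsInvariant φ W) (hVW : IsCompl V W) {J : Finset (Fin k)}
    (hWJ : IsCompl W (⨆ i ∈ J, U i))
    (hiso : ∀ j ∈ J, ∀ i ∉ J, ¬ IsoAsRep φ (U j) (U i)) : V = ⨆ i ∈ J, U i := by
  have hle : V ≤ ⨆ i ∈ J, U i := by
    refine fun x hx => mem_biSup_of_projection_eq_zero hsum fun i hi => ?_
    set q := (U i).projection _ (isCompl_iSup_ne hsum i)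
    set p := V.projection W hVW
    have hT : ∀ γ y, (q ∘ₗ p) (φ γ y) = φ γ ((q ∘ₗ p) y) := fun γ y => by
      rw [LinearMap.comp_apply, projection_comm hV hW, projection_comm (hinv i)
        (IsInvariant.iSup fun j => IsInvariant.iSup fun _ => hinv j), LinearMap.comp_apply]
    have hker : (⊤ : Submodule ℂ (Fin d → ℂ)) ≤ LinearMap.ker (q ∘ₗ p) := by
      rw [← hWJ.sup_eq_top]
      refine sup_le (fun y hy => ?_) (iSup₂_le fun j hj => ?_)
      · rw [LinearMap.mem_ker, LinearMap.comp_apply,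
          (Submodule.projection_apply_eq_zero_iff hVW).2 hy, map_zero]
      · exact eq_zero_of_not_isoAsRep (hinv j) (hirr j) (hirr i) (hiso j hj i hi) hT
          fun y _ => Submodule.projection_apply_mem _ _
    have h : q (p x) = 0 := hker (Submodule.mem_top (x := x))
    rwa [Submodule.projection_apply_of_mem_left hVW hx] at h
  refine eq_of_le_of_inf_le_of_sup_le (z := W) hle ?_ ?_
  · rw [hWJ.symm.inf_eq_bot]
    exact bot_le
  · rw [hVW.sup_eq_top]
    exact le_top

/-- Translating `(⨆ i ∈ I, U i, ⨆ i ∉ I, U i)` by the unipotent maps `1 + t N`, where `N` is an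
isomorphism from `U i` to `U j` extended by zero, yields infinitely many pairs. -/
theorem infinite_fixSet_of_isoAsRep {n m : ℕ} (hd : d = 2 * n + m)
    (hsum : DirectSum.IsInternal U) (hinv : ∀ i, IsInvariant φ (U i))
    (hirr : ∀ i, IsIrreducibleInv φ (U i)) {I : Finset (Fin k)}
    (hI : ∑ i ∈ I, finrank ℂ (U i) = n) {i j : Fin k} (hi : i ∈ I) (hj : j ∉ I)
    (hiso : IsoAsRep φ (U i) (U j)) : (FixSet n m φ).Infinite := by
  obtain ⟨e, he⟩ := hiso
  set A : Submodule ℂ (Fin d → ℂ) := ⨆ i ∈ I, U i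
  set B : Submodule ℂ (Fin d → ℂ) := ⨆ i ∈ Iᶜ, U i
  have hAB : IsCompl A B := isCompl_biSup_compl hsum I
  have hAinv : IsInvariant φ A := IsInvariant.iSup fun l => IsInvariant.iSup fun _ => hinv l
  have hBinv : IsInvariant φ B := IsInvariant.iSup fun l => IsInvariant.iSup fun _ => hinv l
  have hUiA : U i ≤ A := le_iSup₂_of_le i hi le_rfl
  have hUjB : U j ≤ B := le_iSup₂_of_le j (Finset.mem_compl.2 hj) le_rfl
  have hc := isCompl_iSup_ne hsum i
  have hcinv : IsInvariant φ (⨆ l ≠ i, U l) :=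
    IsInvariant.iSup fun l => IsInvariant.iSup fun _ => hinv l
  set N : End ℂ (Fin d → ℂ) :=
    (U j).subtype ∘ₗ e.toLinearMap ∘ₗ Submodule.projectionOnto (U i) _ hc with hN
  have hNmem : ∀ x, N x ∈ U j := fun x => (e _).2
  have hNB : ∀ x ∈ B, N x = 0 := by
    intro x hx
    have hx' : x ∈ ⨆ l ≠ i, U l := by
      refine (iSup₂_le fun l hl => ?_ : B ≤ ⨆ l ≠ i, U l) hx
      exact le_iSup₂_of_le l (fun h => Finset.mem_compl.1 hl (h ▸ hi)) le_rfl
    simp [hN, (Submodule.projectionOnto_apply_eq_zero_iff hc).2 hx']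
  have hNcomm : ∀ γ x, N (φ γ x) = φ γ (N x) := by
    intro γ x
    have h := he γ _ (Submodule.projectionOnto (U i) _ hc x).2
      (hinv i γ _ (Submodule.projectionOnto (U i) _ hc x).2)
    have h' : Submodule.projectionOnto (U i) _ hc (φ γ x) =
        ⟨φ γ (Submodule.projectionOnto (U i) _ hc x),
          hinv i γ _ (Submodule.projectionOnto (U i) _ hc x).2⟩ :=
      Subtype.ext (projection_comm (hinv i) hcinv hc γ x)
    simp only [hN, LinearMap.comp_apply, LinearEquiv.coe_coe, Submodule.subtype_apply, h']
    exact h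
  have hNN : ∀ x, N (N x) = 0 := fun x => hNB _ (hUjB (hNmem x))
  have hdim : finrank ℂ A = n := (finrank_biSup hsum I).trans hI
  have hdimB : finrank ℂ B = n + m := by
    have h := Submodule.finrank_add_eq_of_isCompl hAB
    rw [Module.finrank_fin_fun] at h
    omega
  let g : ℂ → ((Fin d → ℂ) ≃ₗ[ℂ] (Fin d → ℂ)) := fun t =>
    LinearEquiv.ofLinearMap (1 + t • N) (1 - t • N)
      (LinearMap.ext fun x => by simp [hNN]) (LinearMap.ext fun x => by simp [hNN])
  have hg : ∀ t x, g t x = x + t • N x := fun t x => rfl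
  have hgB : ∀ t, B.map (g t : End ℂ (Fin d → ℂ)) = B := by
    intro t
    have hid : ∀ x ∈ B, g t x = x := fun x hx => by rw [hg, hNB x hx, smul_zero, add_zero]
    refine le_antisymm ?_ fun x hx => ⟨x, hx, hid x hx⟩
    rintro _ ⟨x, hx, rfl⟩
    exact (hid x hx).symm ▸ hx
  have hcompl : ∀ t, IsCompl (A.map (g t : End ℂ (Fin d → ℂ))) B := fun t => by
    have h := (Submodule.orderIsoMapComap (g t)).isCompl hAB
    have h' : IsCompl (A.map (g t : End ℂ (Fin d → ℂ))) (B.map (g t : End ℂ (Fin d → ℂ))) := h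
    rwa [hgB] at h'
  refine Set.infinite_of_injective_forall_mem
    (f := fun t => (A.map (g t : End ℂ (Fin d → ℂ)), B)) ?_ ?_
  · intro s t hst
    have hst' : A.map (g s : End ℂ (Fin d → ℂ)) = A.map (g t : End ℂ (Fin d → ℂ)) :=
      congrArg Prod.fst hst
    obtain ⟨x, hx, hx0⟩ := Submodule.exists_mem_ne_zero_of_ne_bot (hirr i).1
    have hNx : N x ≠ 0 := by
      intro h
      have h' : e (Submodule.projectionOnto (U i) _ hc x) = 0 := Subtype.ext h
      rw [LinearEquiv.map_eq_zero_iff, Submodule.projectionOnto_apply_eq_zero_iff] at h'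
      exact hx0 (Submodule.disjoint_def.1 hc.disjoint x hx h')
    have hs : g s x ∈ A.map (g t : End ℂ (Fin d → ℂ)) :=
      hst' ▸ Submodule.mem_map_of_mem (hUiA hx)
    have ht : g t x ∈ A.map (g t : End ℂ (Fin d → ℂ)) := Submodule.mem_map_of_mem (hUiA hx)
    have hsub : g s x - g t x = (s - t) • N x := by
      rw [hg, hg, sub_smul, add_sub_add_left_eq_sub]
    have h := Submodule.disjoint_def.1 (hcompl t).disjoint _ (Submodule.sub_mem _ hs ht)
      (hsub ▸ Submodule.smul_mem _ _ (hUjB (hNmem x)))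
    rw [hsub] at h
    exact sub_eq_zero.1 ((smul_eq_zero.1 h).resolve_right hNx)
  · intro t
    refine ⟨hAinv.map fun γ x => ?_, hBinv, ?_, hdimB, (hcompl t).inf_eq_bot,
      (hcompl t).sup_eq_top⟩
    · change g t (φ γ x) = φ γ (g t x)
      rw [hg, hg, hNcomm, map_add, map_smul]
    · exact (LinearEquiv.finrank_map_eq (g t) A).trans hdim

end Decomposition

/-- `Fix(φ)` is a finite set if and only if condition (★) holds. -/
theorem fixSet_finite_iff_starCondition {n m k : ℕ} (hn : 1 ≤ n)
    (φ : Representation ℂ Γ (Fin (2 * n + m) → ℂ))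
    (U : Fin k → Submodule ℂ (Fin (2 * n + m) → ℂ)) (nι : Fin k → ℕ)
    (hinv : ∀ i, IsInvariant φ (U i)) (hirr : ∀ i, IsIrreducibleInv φ (U i))
    (hsum : DirectSum.IsInternal U)
    (hdim : ∀ i, finrank ℂ (U i) = nι i) :
    (FixSet n m φ).Finite ↔ StarCondition n nι φ U := by
  constructor
  · intro hfin I hI i hi j hj hiso
    refine infinite_fixSet_of_isoAsRep rfl hsum hinv hirr (I := I) ?_ hi hj hiso hfin
    simpa only [hdim] using hI
  · intro hstar
    refine (Set.finite_range fun J : Finset (Fin k) =>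
      (⨆ i ∈ J, U i, ⨆ i ∈ Jᶜ, U i)).subset ?_
    rintro ⟨V, W⟩ ⟨hV, hW, hVdim, -, hinf, hsup⟩
    have hVW : IsCompl V W := ⟨disjoint_iff.2 hinf, codisjoint_iff.2 hsup⟩
    obtain ⟨J, hJ⟩ := exists_isCompl_biSup hsum hinv hirr hW
    have hJn : ∑ i ∈ J, nι i = n := by
      have h₁ := Submodule.finrank_add_eq_of_isCompl hVW
      have h₂ := Submodule.finrank_add_eq_of_isCompl hJ
      rw [finrank_biSup hsum] at h₂
      simp only [hdim] at h₂ hVdim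
      omega
    have hVJ := eq_biSup_of_isCompl hsum hinv hirr hV hW hVW hJ (hstar J hJn)
    refine ⟨J, Prod.ext hVJ.symm (Eq.symm ?_)⟩
    refine eq_biSup_of_isCompl hsum hinv hirr hW hV hVW.symm
      (hVJ ▸ isCompl_biSup_compl hsum J) fun j hj i hi hiso => ?_
    exact hstar J hJn i (by simpa using hi) j (Finset.mem_compl.1 hj) (hiso.symm (hinv j))

end BZSVFix
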